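/- Let G be a directed polymatroidal network and let x ∈ ℝ^{V∪E} be any vector satisfying ∑_{v∈V} deg_v x_v = 0 and ∑_{v∈V} deg_v x_v² > 0. Then there exists a set S ⊆ V with 0 < vol(S) ≤ vol(V)/2 such that cutval(S) ≤ 32 · √(R(x)) · vol(S). -/

import Mathlib

open MeasureTheory

/-- Lovász extension of the set function `f`, with ground set `D`,
evaluated at the (nonnegative) vector `x`. -/
noncomputable def lovOn {E : Type*} (f : Set E → ℝ) (D : Set E) (x : E → ℝ) : ℝ :=
  ∫ θ in Set.Ioi (0 : ℝ), f (D ∩ {e | θ ≤ x e})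

/-- A directed polymatroidal network on vertex type `V` and edge type `E`. -/
structure PolyNet (V E : Type*) [Fintype V] [Fintype E] where
  tail : E → V
  head : E → V
  w : V → ℝ
  w_nonneg : ∀ v, 0 ≤ w v
  ρp : V → Set E → ℝ
  ρm : V → Set E → ℝ
  ρp_nonneg : ∀ v A, 0 ≤ ρp v A
  ρm_nonneg : ∀ v A, 0 ≤ ρm v A
  ρp_empty : ∀ v, ρp v ∅ = 0
  ρm_empty : ∀ v, ρm v ∅ = 0
  ρp_mono : ∀ v A B, A ⊆ B → B ⊆ {e | tail e = v} → ρp v A ≤ ρp v B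
  ρm_mono : ∀ v A B, A ⊆ B → B ⊆ {e | head e = v} → ρm v A ≤ ρm v B
  ρp_submod : ∀ v A B, A ⊆ {e | tail e = v} → B ⊆ {e | tail e = v} →
    ρp v (A ∪ B) + ρp v (A ∩ B) ≤ ρp v A + ρp v B
  ρm_submod : ∀ v A B, A ⊆ {e | head e = v} → B ⊆ {e | head e = v} →
    ρm v (A ∪ B) + ρm v (A ∩ B) ≤ ρm v A + ρm v B

namespace PolyNet

variable {V E : Type*} [Fintype V] [Fintype E] (N : PolyNet V E)

/-- The set of edges leaving `v`. -/
def outE (v : V) : Set E := {e | N.tail e = v}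

/-- The set of edges entering `v`. -/
def inE (v : V) : Set E := {e | N.head e = v}

/-- The degree of a vertex. -/
noncomputable def deg (v : V) : ℝ := N.ρp v (N.outE v) + N.ρm v (N.inE v)

/-- The volume of a set of vertices. -/
noncomputable def vol (S : Set V) : ℝ := ∑ v, S.indicator N.deg v

/-- The total weight of a set of vertices. -/
noncomputable def wsum (S : Set V) : ℝ := ∑ v, S.indicator N.w v

/-- An assignment `g` of (cut) edges to vertices is valid on `F` if every edge of `F` is
assigned to one of its endpoints. -/
def valid (F : Set E) (g : E → V) : Prop := ∀ e ∈ F, g e = N.tail e ∨ g e = N.head e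

/-- The cost of the cut `F` under the assignment `g`. -/
noncomputable def cutCost (F : Set E) (g : E → V) : ℝ :=
  ∑ v, (N.ρp v (N.outE v ∩ F ∩ {e | g e = v}) + N.ρm v (N.inE v ∩ F ∩ {e | g e = v}))

/-- The cost of the cut `F`: minimum over valid assignments. -/
noncomputable def cut (F : Set E) : ℝ :=
  sInf {c | ∃ g : E → V, N.valid F g ∧ c = N.cutCost F g}

/-- Edges from `S` to its complement. -/
def dplus (S : Set V) : Set E := {e | N.tail e ∈ S ∧ N.head e ∉ S}

/-- Edges from the complement of `S` into `S`. -/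
def dminus (S : Set V) : Set E := {e | N.tail e ∉ S ∧ N.head e ∈ S}

/-- The (directed) value of the cut induced by `S`. -/
noncomputable def cutval (S : Set V) : ℝ := min (N.cut (N.dplus S)) (N.cut (N.dminus S))

/-- The symmetric value of the cut induced by `S`. -/
noncomputable def symcutval (S : Set V) : ℝ := N.cut (N.dplus S) + N.cut (N.dminus S)

/-- The Rayleigh quotient `R⁺`. -/
noncomputable def Rp (x : V ⊕ E → ℝ) : ℝ :=
  (∑ v, (lovOn (N.ρp v) (N.outE v) (fun e => (max 0 (x (Sum.inl v) - x (Sum.inr e)))^2)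
       + lovOn (N.ρm v) (N.inE v) (fun e => (max 0 (x (Sum.inr e) - x (Sum.inl v)))^2)))
  / ∑ v, N.deg v * (x (Sum.inl v))^2

/-- The Rayleigh quotient `R⁻`. -/
noncomputable def Rm (x : V ⊕ E → ℝ) : ℝ :=
  (∑ v, (lovOn (N.ρp v) (N.outE v) (fun e => (max 0 (x (Sum.inr e) - x (Sum.inl v)))^2)
       + lovOn (N.ρm v) (N.inE v) (fun e => (max 0 (x (Sum.inl v) - x (Sum.inr e)))^2)))
  / ∑ v, N.deg v * (x (Sum.inl v))^2

/-- The Rayleigh quotient `R`. -/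
noncomputable def Ray (x : V ⊕ E → ℝ) : ℝ := min (N.Rp x) (N.Rm x)

/-- The symmetric Rayleigh quotient `R̄`. -/
noncomputable def RaySym (x : V ⊕ E → ℝ) : ℝ := N.Rp x + N.Rm x

/-- The spectral gap `γ₂` of a polymatroidal network. -/
noncomputable def gap : ℝ :=
  sInf {r | ∃ x : V ⊕ E → ℝ, (∑ v, N.deg v * x (Sum.inl v)) = 0 ∧
    (0 < ∑ v, N.deg v * (x (Sum.inl v))^2) ∧ r = N.Ray x}

end PolyNet

open Set

/-- A nonnegative measurable function on the line, bounded by `M` and vanishing beyond `B`. -/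
structure IsBddProfile (ψ : ℝ → ℝ) (M B : ℝ) : Prop where
  meas : Measurable ψ
  nonneg : ∀ s, 0 ≤ ψ s
  le : ∀ s, ψ s ≤ M
  eq_zero : ∀ s, B < s → ψ s = 0

namespace IsBddProfile

variable {ψ : ℝ → ℝ} {M B : ℝ}

lemma integrableOn (h : IsBddProfile ψ M B) : IntegrableOn ψ (Ioi 0) := by
  have h1 : IntegrableOn ψ (Ioc 0 B) := by
    refine Measure.integrableOn_of_bounded (M := M) (by simp) h.meas.aestronglyMeasurable ?_
    refine Filter.Eventually.of_forall fun s => ?_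
    rw [Real.norm_of_nonneg (h.nonneg s)]
    exact h.le s
  refine h1.of_forall_sdiff_eq_zero measurableSet_Ioi fun s hs => h.eq_zero s ?_
  by_contra hB
  exact hs.2 ⟨hs.1, not_lt.1 hB⟩

lemma integrableOn_mul (h : IsBddProfile ψ M B) :
    IntegrableOn (fun s => 2 * s * ψ s) (Ioi 0) := by
  have h1 : IntegrableOn (fun s => 2 * s * ψ s) (Ioc 0 B) := by
    refine Measure.integrableOn_of_bounded (M := 2 * B * M) (by simp)
      ((measurable_const.mul measurable_id).mul h.meas).aestronglyMeasurable ?_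
    refine (ae_restrict_iff' measurableSet_Ioc).2 (Filter.Eventually.of_forall fun s hs => ?_)
    have hψ := h.nonneg s
    have hs0 := hs.1.le
    rw [Real.norm_of_nonneg (by positivity)]
    exact mul_le_mul (by linarith [hs.2]) (h.le s) hψ (by linarith [hs.2])
  refine h1.of_forall_sdiff_eq_zero measurableSet_Ioi fun s hs => ?_
  rw [h.eq_zero s, mul_zero]
  by_contra hB
  exact hs.2 ⟨hs.1, not_lt.1 hB⟩

lemma integral_mul_nonneg (h : IsBddProfile ψ M B) : 0 ≤ ∫ s in Ioi 0, 2 * s * ψ s := by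
  refine setIntegral_nonneg measurableSet_Ioi fun s hs => ?_
  have := h.nonneg s
  have : (0 : ℝ) < s := hs
  positivity

/-- The weighted arithmetic-geometric form of the Cauchy–Schwarz inequality
`(∫ ψ)² ≤ M ∫ 2 s ψ(s) ds`. -/
lemma two_mul_integral_le (h : IsBddProfile ψ M B) {c k : ℝ} (hc : 0 ≤ c) (hk : 0 < k) :
    2 * c * ∫ s in Ioi 0, ψ s ≤ k * (c ^ 2 * M) + (∫ s in Ioi 0, 2 * s * ψ s) / k := by
  have hM : 0 ≤ M := (h.nonneg 0).trans (h.le 0)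
  have hkc : 0 ≤ k * c := by positivity
  have hlin : ∫ s in Ioc 0 (k * c), 2 * M * (c - s / k) = k * (c ^ 2 * M) := by
    rw [← intervalIntegral.integral_of_le hkc, intervalIntegral.integral_const_mul,
      intervalIntegral.integral_sub (by simp) (by
        exact (continuous_id.div_const k).intervalIntegrable _ _)]
    simp only [intervalIntegral.integral_const, intervalIntegral.integral_div, integral_id]
    simp only [smul_eq_mul]
    field_simp
    ring
  have hint : IntegrableOn (fun s => 2 * M * (c - s / k)) (Ioc 0 (k * c)) :=
    (Continuous.integrableOn_Icc (by fun_prop)).mono_set Ioc_subset_Icc_self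
  have key : ∫ s in Ioi 0, (2 * c * ψ s - 2 * s * ψ s / k)
      ≤ ∫ s in Ioi 0, (Ioc 0 (k * c)).indicator (fun s => 2 * M * (c - s / k)) s := by
    refine setIntegral_mono_on ((h.integrableOn.const_mul _).sub (h.integrableOn_mul.div_const _))
      ((hint.integrable_indicator measurableSet_Ioc).integrableOn) measurableSet_Ioi
      fun s hs => ?_
    have hψ := h.nonneg s
    have hle := h.le s
    have hrw : 2 * c * ψ s - 2 * s * ψ s / k = 2 * ψ s * (c - s / k) := by ring
    rw [hrw]
    by_cases hsk : s ≤ k * c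
    · rw [indicator_of_mem (show s ∈ Ioc 0 (k * c) from ⟨hs, hsk⟩)]
      have : 0 ≤ c - s / k := by
        rw [sub_nonneg, div_le_iff₀ hk]; linarith
      gcongr
    · rw [indicator_of_notMem fun hm => hsk hm.2]
      have : c - s / k ≤ 0 := by
        rw [sub_nonpos, le_div_iff₀ hk]; linarith
      exact mul_nonpos_of_nonneg_of_nonpos (by positivity) this
  rw [integral_sub (h.integrableOn.const_mul _) (h.integrableOn_mul.div_const _),
    integral_const_mul, integral_div, setIntegral_indicator measurableSet_Ioc,
    inter_eq_self_of_subset_right Ioc_subset_Ioi_self, hlin] at key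
  linarith

lemma integrable_indicator (h : IsBddProfile ψ M B) : Integrable ((Ici 0).indicator ψ) :=
  ((integrableOn_Ici_iff_integrableOn_Ioi enorm_ne_top).2 h.integrableOn).integrable_indicator
    measurableSet_Ici

lemma _root_.integral_indicator_Ici_zero (ψ : ℝ → ℝ) :
    ∫ s, (Ici 0).indicator ψ s = ∫ s in Ioi 0, ψ s := by
  rw [integral_indicator measurableSet_Ici, integral_Ici_eq_integral_Ioi]

lemma indicator_nonneg (h : IsBddProfile ψ M B) (s : ℝ) : 0 ≤ (Ici 0).indicator ψ s :=
  Set.indicator_nonneg (fun s _ => h.nonneg s) s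

lemma measurable_indicator (h : IsBddProfile ψ M B) : Measurable ((Ici 0).indicator ψ) :=
  h.meas.indicator measurableSet_Ici

lemma mul_indicator_sub_left_le (h : IsBddProfile ψ M B) (c t : ℝ) :
    2 * t * (Ici 0).indicator ψ (c - t) ≤ 2 * max 0 c * (Ici 0).indicator ψ (c - t) := by
  by_cases hct : t ≤ c
  · have := h.indicator_nonneg (c - t)
    have := hct.trans (le_max_right 0 c)
    gcongr
  · rw [indicator_of_notMem (by simpa using hct)]
    simp

lemma integrableOn_sub_left (h : IsBddProfile ψ M B) (c : ℝ) :
    IntegrableOn (fun t => 2 * t * (Ici 0).indicator ψ (c - t)) (Ioi 0) := by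
  refine Integrable.mono' (((h.integrable_indicator.comp_sub_left c).const_mul
    (2 * max 0 c)).integrableOn) ?_ ?_
  · exact ((measurable_const.mul measurable_id).mul
      (h.measurable_indicator.comp (measurable_const.sub measurable_id))).aestronglyMeasurable
  · refine (ae_restrict_iff' measurableSet_Ioi).2 (Filter.Eventually.of_forall fun t ht => ?_)
    have := h.indicator_nonneg (c - t)
    have ht' : 0 < t := ht
    rw [Real.norm_of_nonneg (by positivity)]
    exact h.mul_indicator_sub_left_le c t

lemma integral_sub_left_le (h : IsBddProfile ψ M B) (c : ℝ) :
    ∫ t in Ioi 0, 2 * t * (Ici 0).indicator ψ (c - t) ≤ 2 * max 0 c * ∫ s in Ioi 0, ψ s := by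
  have hi := (h.integrable_indicator.comp_sub_left c).const_mul (2 * max 0 c)
  calc _ ≤ ∫ t in Ioi 0, 2 * max 0 c * (Ici 0).indicator ψ (c - t) :=
        setIntegral_mono_on (h.integrableOn_sub_left c) hi.integrableOn measurableSet_Ioi
          fun t _ => h.mul_indicator_sub_left_le c t
    _ ≤ ∫ t, 2 * max 0 c * (Ici 0).indicator ψ (c - t) :=
        setIntegral_le_integral hi (Filter.Eventually.of_forall fun t =>
          mul_nonneg (by positivity) (h.indicator_nonneg _))
    _ = _ := by
      rw [integral_const_mul, integral_sub_left_eq_self (fun s => (Ici 0).indicator ψ s) volume c,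
        integral_indicator_Ici_zero]

lemma mul_indicator_sub_right_le (h : IsBddProfile ψ M B) (c t : ℝ) :
    2 * t * (Ici 0).indicator ψ (t - c) ≤
      (Ici 0).indicator (fun s => 2 * s * ψ s + 2 * max 0 c * ψ s) (t - c) := by
  by_cases hct : c ≤ t
  · have hm : t - c ∈ Ici (0 : ℝ) := by simpa using hct
    rw [indicator_of_mem hm, indicator_of_mem hm, ← add_mul]
    have := le_max_right 0 c
    exact mul_le_mul_of_nonneg_right (by linarith) (h.nonneg _)
  · have hm : t - c ∉ Ici (0 : ℝ) := by simpa using hct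
    rw [indicator_of_notMem hm, indicator_of_notMem hm, mul_zero]

lemma integrable_indicator_add (h : IsBddProfile ψ M B) (c : ℝ) :
    Integrable ((Ici 0).indicator (fun s => 2 * s * ψ s + 2 * max 0 c * ψ s)) :=
  ((integrableOn_Ici_iff_integrableOn_Ioi enorm_ne_top).2
    (h.integrableOn_mul.add (h.integrableOn.const_mul _))).integrable_indicator measurableSet_Ici

lemma integrableOn_sub_right (h : IsBddProfile ψ M B) (c : ℝ) :
    IntegrableOn (fun t => 2 * t * (Ici 0).indicator ψ (t - c)) (Ioi 0) := by
  refine Integrable.mono' ((h.integrable_indicator_add c).comp_sub_right c).integrableOn ?_ ?_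
  · exact ((measurable_const.mul measurable_id).mul
      (h.measurable_indicator.comp (measurable_id.sub measurable_const))).aestronglyMeasurable
  · refine (ae_restrict_iff' measurableSet_Ioi).2 (Filter.Eventually.of_forall fun t ht => ?_)
    have := h.indicator_nonneg (t - c)
    have ht' : 0 < t := ht
    rw [Real.norm_of_nonneg (by positivity)]
    exact h.mul_indicator_sub_right_le c t

lemma integral_sub_right_le (h : IsBddProfile ψ M B) (c : ℝ) :
    ∫ t in Ioi 0, 2 * t * (Ici 0).indicator ψ (t - c) ≤
      (∫ s in Ioi 0, 2 * s * ψ s) + 2 * max 0 c * ∫ s in Ioi 0, ψ s := by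
  have hi := (h.integrable_indicator_add c).comp_sub_right c
  calc _ ≤ ∫ t in Ioi 0, (Ici 0).indicator (fun s => 2 * s * ψ s + 2 * max 0 c * ψ s) (t - c) :=
        setIntegral_mono_on (h.integrableOn_sub_right c) hi.integrableOn measurableSet_Ioi
          fun t _ => h.mul_indicator_sub_right_le c t
    _ ≤ ∫ t, (Ici 0).indicator (fun s => 2 * s * ψ s + 2 * max 0 c * ψ s) (t - c) :=
        setIntegral_le_integral hi (Filter.Eventually.of_forall fun t =>
          Set.indicator_nonneg (fun s hs => by
            have hs' : 0 ≤ s := hs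
            have := h.nonneg s
            positivity) _)
    _ = _ := by
      rw [integral_sub_right_eq_self
          (fun s => (Ici 0).indicator (fun s => 2 * s * ψ s + 2 * max 0 c * ψ s) s) c,
        integral_indicator measurableSet_Ici, integral_Ici_eq_integral_Ioi,
        integral_add h.integrableOn_mul (h.integrableOn.const_mul _), integral_const_mul]

end IsBddProfile

section Level

variable {E : Type*}

/-- The value of `f` on the superlevel set of `a` at `s`, inside the ground set `D`. -/
def levelVal (f : Set E → ℝ) (D : Set E) (a : E → ℝ) (s : ℝ) : ℝ := f (D ∩ {e | s ≤ a e})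

lemma measurable_levelVal [Finite E] (f : Set E → ℝ) (D : Set E) (a : E → ℝ) :
    Measurable (levelVal f D a) := by
  have h1 : Measurable fun s : ℝ => D ∩ {e | s ≤ a e} := by
    rw [measurable_set_iff]
    intro e
    exact measurable_const.and (measurableSet_setOfPred.1 measurableSet_Iic)
  exact (measurable_of_finite f).comp h1

lemma isBddProfile_levelVal [Fintype E] {f : Set E → ℝ} {D : Set E}
    (hnn : ∀ A, 0 ≤ f A) (h0 : f ∅ = 0) (hmono : ∀ A B, A ⊆ B → B ⊆ D → f A ≤ f B) (a : E → ℝ) :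
    IsBddProfile (levelVal f D a) (f D) (∑ e, |a e|) where
  meas := measurable_levelVal f D a
  nonneg s := hnn _
  le s := hmono _ _ inter_subset_left subset_rfl
  eq_zero s hs := by
    have : D ∩ {e | s ≤ a e} = ∅ := by
      ext e
      simp only [mem_inter_iff, mem_ofPred_eq, mem_empty_iff_false, iff_false, not_and, not_le]
      intro _
      exact ((le_abs_self _).trans
        (Finset.single_le_sum (f := fun e => |a e|) (fun e _ => abs_nonneg _)
          (Finset.mem_univ e))).trans_lt hs
    rw [levelVal, this, h0]

lemma lovOn_sq (f : Set E → ℝ) (D : Set E) (a : E → ℝ) :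
    lovOn f D (fun e => (max 0 (a e)) ^ 2) = ∫ s in Ioi 0, 2 * s * levelVal f D a s := by
  rw [lovOn, ← integral_comp_rpow_Ioi_of_pos (p := 2)
    (g := fun θ => f (D ∩ {e | θ ≤ (max 0 (a e)) ^ 2})) (by norm_num)]
  refine setIntegral_congr_fun measurableSet_Ioi fun s hs => ?_
  have hs' : 0 < s := hs
  have hset : {e | s ^ (2 : ℝ) ≤ (max 0 (a e)) ^ 2} = {e | s ≤ a e} := by
    ext e
    simp only [mem_ofPred_eq, Real.rpow_two]
    rw [pow_le_pow_iff_left₀ hs'.le (le_max_left _ _) two_ne_zero, le_max_iff]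
    exact or_iff_right (not_le.2 hs')
  have h1 : (2 : ℝ) - 1 = 1 := by norm_num
  simp only [hset, levelVal, smul_eq_mul, h1, Real.rpow_one]

end Level

lemma integrableOn_mul_indicator_Iic (c : ℝ) :
    IntegrableOn (fun t : ℝ => 2 * t * (Iic c).indicator 1 t) (Ioi 0) := by
  have : IsBddProfile ((Iic c).indicator (1 : ℝ → ℝ)) 1 c :=
    ⟨measurable_one.indicator measurableSet_Iic,
      fun s => Set.indicator_nonneg (fun _ _ => zero_le_one) s,
      fun s => indicator_le_self' (fun _ _ => zero_le_one) s,
      fun s hs => indicator_of_notMem (by simpa using hs) _⟩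
  exact this.integrableOn_mul

lemma integral_mul_indicator_Iic (c : ℝ) :
    ∫ t in Ioi (0 : ℝ), 2 * t * (Iic c).indicator 1 t = (max 0 c) ^ 2 := by
  have h1 : (fun t : ℝ => 2 * t * (Iic c).indicator 1 t) = (Iic c).indicator (fun t => 2 * t) := by
    ext t
    by_cases h : t ∈ Iic c <;> simp [h]
  rw [h1, setIntegral_indicator measurableSet_Iic, Ioi_inter_Iic]
  rcases le_total 0 c with hc | hc
  · rw [← intervalIntegral.integral_of_le hc, intervalIntegral.integral_const_mul, integral_id,
      max_eq_right hc]
    ring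
  · rw [Ioc_eq_empty (not_lt.2 hc), max_eq_left hc]
    simp

namespace PolyNet

variable {V E : Type*} [Fintype V] [Fintype E] (N : PolyNet V E)

lemma deg_nonneg (v : V) : 0 ≤ N.deg v := add_nonneg (N.ρp_nonneg _ _) (N.ρm_nonneg _ _)

lemma vol_mono {S T : Set V} (h : S ⊆ T) : N.vol S ≤ N.vol T :=
  Finset.sum_le_sum fun v _ => indicator_le_indicator_of_subset h N.deg_nonneg v

lemma vol_add_vol_compl (S : Set V) : N.vol S + N.vol Sᶜ = N.vol univ := by
  simp only [vol, ← Finset.sum_add_distrib, indicator_self_add_compl_apply, indicator_univ]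

lemma vol_empty : N.vol ∅ = 0 := by simp [vol]

lemma cut_le_cutCost {F : Set E} {g : E → V} (hg : N.valid F g) : N.cut F ≤ N.cutCost F g := by
  refine csInf_le ⟨0, ?_⟩ ⟨g, hg, rfl⟩
  rintro c ⟨g', _, rfl⟩
  exact Finset.sum_nonneg fun v _ => add_nonneg (N.ρp_nonneg _ _) (N.ρm_nonneg _ _)

lemma cut_dplus_le_vol (S : Set V) : N.cut (N.dplus S) ≤ N.vol S := by
  refine (N.cut_le_cutCost (g := N.tail) fun e _ => Or.inl rfl).trans
    (Finset.sum_le_sum fun v _ => ?_)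
  have h1 : N.inE v ∩ N.dplus S ∩ {e | N.tail e = v} = ∅ := by
    refine eq_empty_of_forall_notMem ?_
    rintro e ⟨⟨h, h2, h3⟩, h4⟩
    have h : N.head e = v := h
    have h4 : N.tail e = v := h4
    exact h3 (h ▸ h4 ▸ h2)
  rw [h1, N.ρm_empty, add_zero]
  by_cases hv : v ∈ S
  · rw [indicator_of_mem hv]
    have := N.ρp_mono v (N.outE v ∩ N.dplus S ∩ {e | N.tail e = v}) (N.outE v)
      (fun e he => he.1.1) subset_rfl
    have := N.ρm_nonneg v (N.inE v)
    rw [deg]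
    linarith
  · rw [indicator_of_notMem hv]
    have h2 : N.outE v ∩ N.dplus S ∩ {e | N.tail e = v} = ∅ := by
      refine eq_empty_of_forall_notMem ?_
      rintro e ⟨⟨_, h2, _⟩, h4⟩
      have h4 : N.tail e = v := h4
      exact hv (h4 ▸ h2)
    rw [h2, N.ρp_empty]

/-- The capacity of the out-edges `e` of `v` with `x_v - x_e ≥ s`, as a function of `s`. -/
def tailProfile (x : V ⊕ E → ℝ) (v : V) : ℝ → ℝ :=
  levelVal (N.ρp v) (N.outE v) fun e => x (Sum.inl v) - x (Sum.inr e)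

/-- The capacity of the in-edges `e` of `v` with `x_e - x_v ≥ s`, as a function of `s`. -/
def headProfile (x : V ⊕ E → ℝ) (v : V) : ℝ → ℝ :=
  levelVal (N.ρm v) (N.inE v) fun e => x (Sum.inr e) - x (Sum.inl v)

lemma isBddProfile_tailProfile (x : V ⊕ E → ℝ) (v : V) :
    IsBddProfile (N.tailProfile x v) (N.ρp v (N.outE v))
      (∑ e, |x (Sum.inl v) - x (Sum.inr e)|) :=
  isBddProfile_levelVal (N.ρp_nonneg v) (N.ρp_empty v) (N.ρp_mono v) _

lemma isBddProfile_headProfile (x : V ⊕ E → ℝ) (v : V) :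
    IsBddProfile (N.headProfile x v) (N.ρm v (N.inE v))
      (∑ e, |x (Sum.inr e) - x (Sum.inl v)|) :=
  isBddProfile_levelVal (N.ρm_nonneg v) (N.ρm_empty v) (N.ρm_mono v) _

/-- The numerator of the Rayleigh quotient `R⁺`. -/
noncomputable def energy (x : V ⊕ E → ℝ) : ℝ :=
  ∑ v, (lovOn (N.ρp v) (N.outE v) (fun e => (max 0 (x (Sum.inl v) - x (Sum.inr e)))^2)
       + lovOn (N.ρm v) (N.inE v) (fun e => (max 0 (x (Sum.inr e) - x (Sum.inl v)))^2))

lemma energy_eq (x : V ⊕ E → ℝ) :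
    N.energy x = ∑ v, ((∫ s in Ioi 0, 2 * s * N.tailProfile x v s) +
      ∫ s in Ioi 0, 2 * s * N.headProfile x v s) := by
  simp only [energy, lovOn_sq, tailProfile, headProfile]

lemma energy_nonneg (x : V ⊕ E → ℝ) : 0 ≤ N.energy x := by
  rw [energy_eq]
  exact Finset.sum_nonneg fun v _ => add_nonneg (N.isBddProfile_tailProfile x v).integral_mul_nonneg
    (N.isBddProfile_headProfile x v).integral_mul_nonneg

/-- Upper bound for the value of the cut at the superlevel set of height `t`. -/
noncomputable def levelBound (x : V ⊕ E → ℝ) (t : ℝ) : ℝ :=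
  ∑ v, ((Ici 0).indicator (N.tailProfile x v) (x (Sum.inl v) - t) +
    (Ici 0).indicator (N.headProfile x v) (t - x (Sum.inl v)))

lemma cut_dplus_level_le (x : V ⊕ E → ℝ) (t : ℝ) :
    N.cut (N.dplus {v | t ≤ x (Sum.inl v)}) ≤ N.levelBound x t := by
  classical
  set F := N.dplus {v | t ≤ x (Sum.inl v)}
  have htail : ∀ e ∈ F, t ≤ x (Sum.inl (N.tail e)) := fun e he => he.1
  have hhead : ∀ e ∈ F, x (Sum.inl (N.head e)) < t := fun e he => not_le.1 he.2
  let g : E → V := fun e => if x (Sum.inr e) < t then N.tail e else N.head e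
  have hg : N.valid F g := fun e _ => by
    by_cases h : x (Sum.inr e) < t <;> simp [g, h]
  refine (N.cut_le_cutCost hg).trans (Finset.sum_le_sum fun v _ => add_le_add ?_ ?_)
  · have hmem : ∀ e ∈ N.outE v ∩ F ∩ {e | g e = v},
        t ≤ x (Sum.inl v) ∧ x (Sum.inr e) < t := by
      rintro e ⟨⟨h1, h2⟩, h3⟩
      have h1 : N.tail e = v := h1
      have h3 : g e = v := h3
      have h4 := htail e h2
      have h5 := hhead e h2
      rw [h1] at h4
      refine ⟨h4, ?_⟩
      by_contra hlt
      simp only [g, hlt, if_false] at h3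
      rw [h3] at h5
      exact absurd h4 (not_le.2 h5)
    by_cases ht : t ≤ x (Sum.inl v)
    · rw [indicator_of_mem (by simpa using ht)]
      refine N.ρp_mono v _ _ (fun e he => ⟨he.1.1, ?_⟩) inter_subset_left
      have := (hmem e he).2
      change x (Sum.inl v) - t ≤ x (Sum.inl v) - x (Sum.inr e)
      linarith
    · rw [eq_empty_of_forall_notMem fun e he => ht (hmem e he).1, N.ρp_empty]
      exact (N.isBddProfile_tailProfile x v).indicator_nonneg _
  · have hmem : ∀ e ∈ N.inE v ∩ F ∩ {e | g e = v},
        x (Sum.inl v) < t ∧ t ≤ x (Sum.inr e) := by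
      rintro e ⟨⟨h1, h2⟩, h3⟩
      have h1 : N.head e = v := h1
      have h3 : g e = v := h3
      have h4 := htail e h2
      have h5 := hhead e h2
      rw [h1] at h5
      refine ⟨h5, ?_⟩
      by_contra hlt
      simp only [g, not_le.1 hlt, if_true] at h3
      rw [h3] at h4
      exact absurd h4 (not_le.2 h5)
    by_cases ht : x (Sum.inl v) < t
    · rw [indicator_of_mem (by simpa using ht.le)]
      refine N.ρm_mono v _ _ (fun e he => ⟨he.1.1, ?_⟩) inter_subset_left
      have := (hmem e he).2
      change t - x (Sum.inl v) ≤ x (Sum.inr e) - x (Sum.inl v)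
      linarith
    · rw [eq_empty_of_forall_notMem fun e he => ht (hmem e he).1, N.ρm_empty]
      exact (N.isBddProfile_headProfile x v).indicator_nonneg _

lemma two_mul_levelBound (x : V ⊕ E → ℝ) (t : ℝ) : 2 * t * N.levelBound x t =
    ∑ v, (2 * t * (Ici 0).indicator (N.tailProfile x v) (x (Sum.inl v) - t) +
      2 * t * (Ici 0).indicator (N.headProfile x v) (t - x (Sum.inl v))) := by
  simp only [levelBound, Finset.mul_sum, mul_add]

lemma integrableOn_levelBound (x : V ⊕ E → ℝ) :
    IntegrableOn (fun t => 2 * t * N.levelBound x t) (Ioi 0) := by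
  simp only [two_mul_levelBound]
  exact integrable_finsetSum _ fun v _ =>
    ((N.isBddProfile_tailProfile x v).integrableOn_sub_left _).add
      ((N.isBddProfile_headProfile x v).integrableOn_sub_right _)

lemma integral_levelBound_le (x : V ⊕ E → ℝ) {k : ℝ} (hk : 0 < k) :
    ∫ t in Ioi 0, 2 * t * N.levelBound x t ≤
      k * (∑ v, N.deg v * (max 0 (x (Sum.inl v))) ^ 2) + N.energy x / k + N.energy x := by
  simp only [two_mul_levelBound]
  rw [integral_finsetSum Finset.univ fun v _ => by
    exact ((N.isBddProfile_tailProfile x v).integrableOn_sub_left _).add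
      ((N.isBddProfile_headProfile x v).integrableOn_sub_right _), energy_eq, Finset.mul_sum,
    Finset.sum_div, ← Finset.sum_add_distrib, ← Finset.sum_add_distrib]
  refine Finset.sum_le_sum fun v _ => ?_
  have hp := N.isBddProfile_tailProfile x v
  have hm := N.isBddProfile_headProfile x v
  rw [integral_add (hp.integrableOn_sub_left _) (hm.integrableOn_sub_right _)]
  have h1 := hp.integral_sub_left_le (x (Sum.inl v))
  have h2 := hm.integral_sub_right_le (x (Sum.inl v))
  have h3 := hp.two_mul_integral_le (le_max_left 0 (x (Sum.inl v))) hk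
  have h4 := hm.two_mul_integral_le (le_max_left 0 (x (Sum.inl v))) hk
  rw [deg, add_div, add_mul, mul_add, mul_comm (N.ρp _ _), mul_comm (N.ρm _ _)]
  linarith [hp.integral_mul_nonneg]

lemma two_mul_vol_level (x : V ⊕ E → ℝ) (t : ℝ) : 2 * t * N.vol {v | t ≤ x (Sum.inl v)} =
    ∑ v, N.deg v * (2 * t * (Iic (x (Sum.inl v))).indicator 1 t) := by
  rw [vol, Finset.mul_sum]
  refine Finset.sum_congr rfl fun v _ => ?_
  by_cases h : t ≤ x (Sum.inl v)
  · rw [indicator_of_mem (by exact h), indicator_of_mem (by exact h), Pi.one_apply]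
    ring
  · rw [indicator_of_notMem (by exact h), indicator_of_notMem (by exact h)]
    ring

lemma integrableOn_vol_level (x : V ⊕ E → ℝ) :
    IntegrableOn (fun t => 2 * t * N.vol {v | t ≤ x (Sum.inl v)}) (Ioi 0) := by
  simp only [two_mul_vol_level]
  exact integrable_finsetSum _ fun v _ => (integrableOn_mul_indicator_Iic _).const_mul _

lemma integral_vol_level (x : V ⊕ E → ℝ) :
    ∫ t in Ioi 0, 2 * t * N.vol {v | t ≤ x (Sum.inl v)} =
      ∑ v, N.deg v * (max 0 (x (Sum.inl v))) ^ 2 := by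
  simp only [two_mul_vol_level]
  rw [integral_finsetSum _ fun v _ => (integrableOn_mul_indicator_Iic _).const_mul _]
  simp only [integral_const_mul, integral_mul_indicator_Iic]

lemma exists_pos_of_sum_pos {x : V ⊕ E → ℝ}
    (hZ : 0 < ∑ v, N.deg v * (max 0 (x (Sum.inl v))) ^ 2) :
    ∃ r > 0, ∀ t ≤ r, 0 < N.vol {v | t ≤ x (Sum.inl v)} := by
  obtain ⟨v, -, hv⟩ := Finset.exists_lt_of_sum_lt (s := Finset.univ) (f := fun _ : V => (0 : ℝ))
    (by simpa using hZ)
  have hx : 0 < x (Sum.inl v) := by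
    by_contra h
    rw [max_eq_left (not_lt.1 h)] at hv
    simp at hv
  refine ⟨_, hx, fun t ht => ?_⟩
  have hd : 0 < N.deg v := pos_of_mul_pos_left hv (sq_nonneg _)
  refine hd.trans_le ?_
  have := Finset.single_le_sum (f := fun u => indicator {v | t ≤ x (Sum.inl v)} N.deg u)
    (fun u _ => Set.indicator_nonneg (fun u _ => N.deg_nonneg u) u) (Finset.mem_univ v)
  simpa only [vol, indicator_of_mem (show v ∈ {v | t ≤ x (Sum.inl v)} from ht)] using this

/-- Threshold rounding of the positive part of `x`. -/
lemma exists_level_cut {x : V ⊕ E → ℝ} {R : ℝ} (hR : 0 ≤ R)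
    (hZ : 0 < ∑ v, N.deg v * (max 0 (x (Sum.inl v))) ^ 2)
    (hQ : N.energy x ≤ 2 * R * ∑ v, N.deg v * (max 0 (x (Sum.inl v))) ^ 2) :
    ∃ t > 0, 0 < N.vol {v | t ≤ x (Sum.inl v)} ∧
      N.cut (N.dplus {v | t ≤ x (Sum.inl v)}) ≤
        32 * √R * N.vol {v | t ≤ x (Sum.inl v)} := by
  obtain ⟨r, hr, hvol⟩ := N.exists_pos_of_sum_pos hZ
  rcases lt_or_ge 1 R with hR1 | hR1
  · refine ⟨r, hr, hvol r le_rfl, (N.cut_dplus_le_vol _).trans ?_⟩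
    have : 1 ≤ √R := Real.one_le_sqrt.2 hR1.le
    nlinarith [hvol r le_rfl]
  by_contra! hcon
  set Z := ∑ v, N.deg v * (max 0 (x (Sum.inl v))) ^ 2
  have hI : ∫ t in Ioi 0, 2 * t * N.levelBound x t ≤ 32 * √R * Z := by
    have hs := Real.sq_sqrt hR
    have hs1 : √R ≤ 1 := Real.sqrt_le_one.2 hR1
    rcases (Real.sqrt_nonneg R).eq_or_lt with h0 | h0
    · have hE : N.energy x = 0 := by
        refine le_antisymm (hQ.trans ?_) (N.energy_nonneg x)
        rw [← hs, ← h0]; simp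
      rw [← h0]
      refine le_of_forall_pos_le_add fun ε hε => ?_
      have := N.integral_levelBound_le x (div_pos hε hZ)
      rw [hE, div_mul_cancel₀ _ hZ.ne'] at this
      simpa using this
    · have := N.integral_levelBound_le x h0
      have hdiv : N.energy x / √R ≤ 2 * √R * Z := by
        rw [div_le_iff₀ h0]
        calc _ ≤ _ := hQ
          _ = 2 * √R * Z * √R := by nth_rewrite 1 [← hs]; ring
      have hQ' : N.energy x ≤ 2 * √R * Z := by
        refine hQ.trans ?_
        gcongr
        nlinarith
      have : 0 < √R * Z := by positivity
      linarith
  have hvol0 : ∀ t, 0 ≤ N.vol {v | t ≤ x (Sum.inl v)} := fun t =>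
    N.vol_empty ▸ N.vol_mono (empty_subset _)
  have hbound : ∀ t > 0, 32 * √R * N.vol {v | t ≤ x (Sum.inl v)} ≤ N.levelBound x t := by
    intro t ht
    rcases (hvol0 t).eq_or_lt with h | h
    · rw [← h, mul_zero]
      exact Finset.sum_nonneg fun v _ => add_nonneg
        ((N.isBddProfile_tailProfile x v).indicator_nonneg _)
        ((N.isBddProfile_headProfile x v).indicator_nonneg _)
    · exact (hcon t ht h).le.trans (N.cut_dplus_level_le x t)
  have hint : IntegrableOn (fun t => 2 * t * N.levelBound x t -
      32 * √R * (2 * t * N.vol {v | t ≤ x (Sum.inl v)})) (Ioi 0) :=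
    (N.integrableOn_levelBound x).sub ((N.integrableOn_vol_level x).const_mul _)
  have hpos : 0 < ∫ t in Ioi 0, (2 * t * N.levelBound x t -
      32 * √R * (2 * t * N.vol {v | t ≤ x (Sum.inl v)})) := by
    rw [setIntegral_pos_iff_support_of_nonneg_ae _ hint]
    · refine lt_of_lt_of_le ?_ (measure_mono (μ := volume) (s := Ioc 0 r) ?_)
      · simpa using hr
      · refine fun t ht => ⟨ne_of_gt ?_, ht.1⟩
        have h1 := (hcon t ht.1 (hvol t ht.2)).trans_le (N.cut_dplus_level_le x t)
        have h2 : 0 < t := ht.1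
        nlinarith
    · refine (ae_restrict_iff' measurableSet_Ioi).2 (Filter.Eventually.of_forall fun t ht => ?_)
      have h1 := hbound t ht
      have h2 : 0 < t := ht
      simp only [Pi.zero_apply]
      nlinarith
  rw [integral_sub (N.integrableOn_levelBound x) ((N.integrableOn_vol_level x).const_mul _),
    integral_const_mul, integral_vol_level] at hpos
  linarith

/-- The network with all edges reversed. -/
def reverse : PolyNet V E where
  tail := N.head
  head := N.tail
  w := N.w
  w_nonneg := N.w_nonneg
  ρp := N.ρm
  ρm := N.ρp
  ρp_nonneg := N.ρm_nonneg
  ρm_nonneg := N.ρp_nonneg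
  ρp_empty := N.ρm_empty
  ρm_empty := N.ρp_empty
  ρp_mono := N.ρm_mono
  ρm_mono := N.ρp_mono
  ρp_submod := N.ρm_submod
  ρm_submod := N.ρp_submod

lemma deg_reverse : N.reverse.deg = N.deg := by
  funext v
  exact add_comm _ _

lemma vol_reverse (S : Set V) : N.reverse.vol S = N.vol S := by
  simp only [vol, deg_reverse]

lemma cut_reverse (F : Set E) : N.reverse.cut F = N.cut F := by
  have h1 : ∀ g, N.reverse.cutCost F g = N.cutCost F g := fun g =>
    Finset.sum_congr rfl fun v _ => add_comm _ _
  have h2 : ∀ g, N.reverse.valid F g ↔ N.valid F g := fun g =>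
    forall₂_congr fun e _ => or_comm
  simp only [cut, h1, h2]

lemma dplus_reverse (S : Set V) : N.reverse.dplus S = N.dminus S := by
  ext e
  exact and_comm

lemma energy_reverse_neg (x : V ⊕ E → ℝ) : N.reverse.energy (-x) = N.energy x := by
  refine Finset.sum_congr rfl fun v _ => ?_
  rw [add_comm]
  simp only [Pi.neg_apply, neg_sub_neg]
  rfl

lemma energy_sub_const (x : V ⊕ E → ℝ) (m : ℝ) : N.energy (fun i => x i - m) = N.energy x := by
  simp only [energy, sub_sub_sub_cancel_right]

/-- Existence of a weighted median. -/
lemma exists_median [Nonempty V] (x : V → ℝ) :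
    ∃ m, N.vol {v | m < x v} ≤ N.vol univ / 2 ∧ N.vol {v | x v < m} ≤ N.vol univ / 2 := by
  have hvol : 0 ≤ N.vol univ := N.vol_empty ▸ N.vol_mono (empty_subset _)
  obtain ⟨a, ha⟩ := Finite.exists_max x
  obtain ⟨b, hb, hmin⟩ :=
    (Set.toFinite {u | N.vol {v | x u < x v} ≤ N.vol univ / 2}).exists_minimalFor x _ ⟨a, by
      have : {v | x a < x v} = ∅ := eq_empty_of_forall_notMem fun v hv => (ha v).not_gt hv
      change N.vol _ ≤ _
      rw [this, vol_empty]
      linarith⟩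
  refine ⟨x b, hb, ?_⟩
  rcases {v | x v < x b}.eq_empty_or_nonempty with h | h
  · rw [h, vol_empty]
    linarith
  obtain ⟨u, hu, hmax⟩ := (Set.toFinite {v | x v < x b}).exists_maximalFor x _ h
  have hu' : x u < x b := hu
  have h1 : N.vol univ / 2 < N.vol {v | x u < x v} := by
    by_contra hle
    exact absurd (hmin (not_lt.1 hle) hu'.le) (not_le.2 hu')
  have h2 : {v | x v < x b} ⊆ {v | x u < x v}ᶜ := by
    intro v hv huv
    exact absurd (hmax hv (le_of_lt huv)) (not_le.2 huv)
  have := N.vol_mono h2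
  have := N.vol_add_vol_compl {v | x u < x v}
  linarith

lemma exists_cutval_le_Rp (x : V ⊕ E → ℝ) (hmean : (∑ v, N.deg v * x (Sum.inl v)) = 0)
    (hpos : 0 < ∑ v, N.deg v * (x (Sum.inl v)) ^ 2) :
    ∃ S : Set V, 0 < N.vol S ∧ N.vol S ≤ N.vol univ / 2 ∧
      N.cutval S ≤ 32 * √(N.Rp x) * N.vol S := by
  have hne : Nonempty V := by
    by_contra h
    rw [not_nonempty_iff] at h
    simp at hpos
  obtain ⟨m, hm1, hm2⟩ := N.exists_median fun v => x (Sum.inl v)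
  set D := ∑ v, N.deg v * (x (Sum.inl v)) ^ 2
  have hRp : N.Rp x = N.energy x / D := rfl
  have hR : 0 ≤ N.Rp x := by
    rw [hRp]
    exact div_nonneg (N.energy_nonneg x) hpos.le
  have hQ : N.energy x = N.Rp x * D := by rw [hRp, div_mul_cancel₀ _ hpos.ne']
  set y : V ⊕ E → ℝ := fun i => x i - m with hy
  have hsum : D ≤ (∑ v, N.deg v * (max 0 (y (Sum.inl v))) ^ 2) +
      ∑ v, N.deg v * (max 0 ((-y) (Sum.inl v))) ^ 2 := by
    have h1 : (∑ v, N.deg v * (max 0 (y (Sum.inl v))) ^ 2) +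
        ∑ v, N.deg v * (max 0 ((-y) (Sum.inl v))) ^ 2 =
        ∑ v, (N.deg v * (x (Sum.inl v)) ^ 2 - 2 * m * (N.deg v * x (Sum.inl v)) +
          N.deg v * m ^ 2) := by
      rw [← Finset.sum_add_distrib]
      refine Finset.sum_congr rfl fun v _ => ?_
      have h2 : (max 0 (y (Sum.inl v))) ^ 2 + (max 0 ((-y) (Sum.inl v))) ^ 2 =
          (x (Sum.inl v) - m) ^ 2 := by
        simp only [hy, Pi.neg_apply]
        rcases le_total 0 (x (Sum.inl v) - m) with h | h
        · rw [max_eq_right h, max_eq_left (by linarith)]; ring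
        · rw [max_eq_left h, max_eq_right (by linarith)]; ring
      rw [← mul_add, h2]
      ring
    rw [h1, Finset.sum_add_distrib, Finset.sum_sub_distrib, ← Finset.mul_sum, hmean]
    have : 0 ≤ ∑ v, N.deg v * m ^ 2 :=
      Finset.sum_nonneg fun v _ => mul_nonneg (N.deg_nonneg v) (sq_nonneg m)
    linarith
  rcases le_total (D / 2) (∑ v, N.deg v * (max 0 (y (Sum.inl v))) ^ 2) with hZ | hZ
  · obtain ⟨t, ht, h1, h2⟩ := N.exists_level_cut (x := y) hR (by linarith) (by
      rw [hy, energy_sub_const, hQ]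
      nlinarith)
    refine ⟨_, h1, (N.vol_mono fun v hv => ?_).trans hm1, (min_le_left _ _).trans h2⟩
    have hv : t ≤ x (Sum.inl v) - m := hv
    change m < x (Sum.inl v)
    linarith
  · have hZ' : D / 2 ≤ ∑ v, N.deg v * (max 0 ((-y) (Sum.inl v))) ^ 2 := by linarith
    obtain ⟨t, ht, h1, h2⟩ := N.reverse.exists_level_cut (x := -y) hR
      (by rw [deg_reverse]; linarith) (by
        rw [deg_reverse, energy_reverse_neg, hy, energy_sub_const, hQ]
        nlinarith)
    rw [vol_reverse] at h1 h2
    rw [dplus_reverse, cut_reverse] at h2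
    refine ⟨_, h1, (N.vol_mono fun v hv => ?_).trans hm2, (min_le_right _ _).trans h2⟩
    have hv : t ≤ -(x (Sum.inl v) - m) := hv
    change x (Sum.inl v) < m
    linarith

lemma Rp_neg (x : V ⊕ E → ℝ) : N.Rp (-x) = N.Rm x := by
  simp only [Rp, Rm, Pi.neg_apply, neg_sub_neg, neg_sq]

end PolyNet

/-- Rounding a vector into a sparse directed cut: for any `x` with
`∑ deg_v x_v = 0` and `∑ deg_v x_v² > 0` there is a set `S` with
`0 < vol S ≤ vol V / 2` and `cutval S ≤ 32 √(R(x)) · vol S`. -/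
theorem cheeger_rounding {V E : Type*} [Fintype V] [Fintype E] (N : PolyNet V E)
    (x : V ⊕ E → ℝ) (hmean : (∑ v, N.deg v * x (Sum.inl v)) = 0)
    (hpos : 0 < ∑ v, N.deg v * (x (Sum.inl v))^2) :
    ∃ S : Set V, 0 < N.vol S ∧ N.vol S ≤ N.vol Set.univ / 2 ∧
      N.cutval S ≤ 32 * Real.sqrt (N.Ray x) * N.vol S := by
  rcases min_choice (N.Rp x) (N.Rm x) with h | h
  · rw [PolyNet.Ray, h]
    exact N.exists_cutval_le_Rp x hmean hpos
  · rw [PolyNet.Ray, h, ← N.Rp_neg]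
    exact N.exists_cutval_le_Rp (-x) (by simpa using hmean) (by simpa using hpos)
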